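/- For every odd positive integer n, Player 1 has a winning strategy in the Build Up 1-2-3 game on n. -/

import Mathlib

/-- The Fibonacci numbers indexed so that `zfib 1 = 1`, `zfib 2 = 2`,
and `zfib (i+1) = zfib i + zfib (i-1)`. -/
def zfib (i : ℕ) : ℕ := Nat.fib (i + 1)

/-- A game state: a finitely supported function recording the height of each bin.
Bin indices start at `1`; index `0` is unused. -/
abbrev ZState := ℕ →₀ ℕ

/-- The legal moves of the reversed Zeckendorf game. -/
inductive ZMove : ZState → ZState → Prop
  | split (h : ZState) (i : ℕ) (hi : 2 ≤ i) (hpos : 0 < h (i + 1)) :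
      ZMove h (h - Finsupp.single (i + 1) 1 + Finsupp.single i 1 + Finsupp.single (i - 1) 1)
  | splitTwo (h : ZState) (hpos : 0 < h 2) :
      ZMove h (h - Finsupp.single 2 1 + Finsupp.single 1 2)
  | combine (h : ZState) (i : ℕ) (hi : 2 < i) (h1 : 0 < h (i + 1)) (h2 : 0 < h (i - 2)) :
      ZMove h (h - Finsupp.single (i + 1) 1 - Finsupp.single (i - 2) 1 + Finsupp.single i 2)
  | combineTwo (h : ZState) (h1 : 0 < h 3) (h2 : 0 < h 1) :
      ZMove h (h - Finsupp.single 3 1 - Finsupp.single 1 1 + Finsupp.single 2 2)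

/-- A position of the Build Up 1-2-3 game on `n`: the running total `s` of the
building phase together with the current game state (which during the building
phase records the counts of played 1s, 2s and 3s in bins 1, 2 and 3). -/
abbrev BUPos := ℕ × ZState

/-- The legal moves of the Build Up 1-2-3 game on `n`: while the running total is
below `n`, put down a `1`, `2` or `3` without exceeding `n`; once the total is
exactly `n`, make reversed Zeckendorf moves on the accumulated state. -/
inductive BUMove (n : ℕ) : BUPos → BUPos → Prop
  | build (s : ℕ) (h : ZState) (k : ℕ) (hk : k = 1 ∨ k = 2 ∨ k = 3) (hs : s + k ≤ n) :
      BUMove n (s, h) (s + k, h + Finsupp.single k 1)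
  | play (h h' : ZState) (hm : ZMove h h') : BUMove n (n, h) (n, h')

mutual
  /-- The position is a win for the player to move. -/
  inductive BUFirstWin (n : ℕ) : BUPos → Prop
    | intro (p q : BUPos) (m : BUMove n p q) (hl : BULoss n q) : BUFirstWin n p
  /-- The position is a loss for the player to move. -/
  inductive BULoss (n : ℕ) : BUPos → Prop
    | intro (p : BUPos) (hall : ∀ q, BUMove n p q → BUFirstWin n q) : BULoss n p
end

noncomputable def st (a b c : ℕ) : ZState :=
  Finsupp.single 1 a + Finsupp.single 2 b + Finsupp.single 3 c

lemma st_apply (a b c i : ℕ) :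
    st a b c i = (if 1 = i then a else 0) + (if 2 = i then b else 0) + (if 3 = i then c else 0) := by
  simp [st, Finsupp.single_apply]

lemma moveA (a b c : ℕ) : st a b (c+1) - Finsupp.single (2+1) 1 + Finsupp.single 2 1
    + Finsupp.single (2-1) 1 = st (a+1) (b+1) c := by
  ext i
  simp only [Finsupp.add_apply, Finsupp.tsub_apply, st_apply, Finsupp.single_apply]
  split_ifs <;> omega

lemma moveB (a b c : ℕ) : st a (b+1) c - Finsupp.single 2 1 + Finsupp.single 1 2
    = st (a+2) b c := by
  ext i
  simp only [Finsupp.add_apply, Finsupp.tsub_apply, st_apply, Finsupp.single_apply]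
  split_ifs <;> omega

lemma moveC (a b c : ℕ) : st (a+1) b (c+1) - Finsupp.single 3 1 - Finsupp.single 1 1
    + Finsupp.single 2 2 = st a (b+2) c := by
  ext i
  simp only [Finsupp.add_apply, Finsupp.tsub_apply, st_apply, Finsupp.single_apply]
  split_ifs <;> omega

lemma build1 (a b c : ℕ) : st a b c + Finsupp.single 1 1 = st (a+1) b c := by
  ext i
  simp only [Finsupp.add_apply, st_apply, Finsupp.single_apply]
  split_ifs <;> omega

lemma build2 (a b c : ℕ) : st a b c + Finsupp.single 2 1 = st a (b+1) c := by
  ext i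
  simp only [Finsupp.add_apply, st_apply, Finsupp.single_apply]
  split_ifs <;> omega

lemma build3 (a b c : ℕ) : st a b c + Finsupp.single 3 1 = st a b (c+1) := by
  ext i
  simp only [Finsupp.add_apply, st_apply, Finsupp.single_apply]
  split_ifs <;> omega

lemma ZMove.inv {h h' : ZState} (m : ZMove h h') : ∀ a b c, h = st a b c →
    (∃ c', c = c'+1 ∧ h' = st (a+1) (b+1) c') ∨ (∃ b', b = b'+1 ∧ h' = st (a+2) b' c) ∨
    (∃ a' c', a = a'+1 ∧ c = c'+1 ∧ h' = st a' (b+2) c') := by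
  intro a b c e
  cases m with
  | split i hi hpos =>
    subst e
    rw [st_apply] at hpos
    have : i = 2 := by split_ifs at hpos <;> omega
    subst this
    obtain ⟨c', rfl⟩ : ∃ c', c = c'+1 := ⟨c-1, by simp at hpos; omega⟩
    exact Or.inl ⟨c', rfl, moveA _ _ _⟩
  | splitTwo hpos =>
    subst e
    rw [st_apply] at hpos
    obtain ⟨b', rfl⟩ : ∃ b', b = b'+1 := ⟨b-1, by simp at hpos; omega⟩
    exact Or.inr (Or.inl ⟨b', rfl, moveB _ _ _⟩)
  | combine i hi h1 h2 =>
    subst e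
    rw [st_apply] at h1
    split_ifs at h1 <;> omega
  | combineTwo h1 h2 =>
    subst e
    rw [st_apply] at h1 h2
    obtain ⟨c', rfl⟩ : ∃ c', c = c'+1 := ⟨c-1, by simp at h1; omega⟩
    obtain ⟨a', rfl⟩ : ∃ a', a = a'+1 := ⟨a-1, by simp at h2; omega⟩
    exact Or.inr (Or.inr ⟨a', c', rfl, rfl, moveC _ _ _⟩)

lemma BUMove.inv {n : ℕ} {p q : BUPos} (m : BUMove n p q) : ∀ s a b c, p = (s, st a b c) →
    (s + 1 ≤ n ∧ q = (s+1, st (a+1) b c)) ∨ (s + 2 ≤ n ∧ q = (s+2, st a (b+1) c)) ∨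
    (s + 3 ≤ n ∧ q = (s+3, st a b (c+1))) ∨ (s = n ∧ ∃ h', q = (n, h') ∧ ZMove (st a b c) h') := by
  intro s a b c e
  cases m with
  | build s' h k hk hs =>
    obtain ⟨rfl, rfl⟩ := Prod.mk.inj e
    rcases hk with rfl | rfl | rfl
    · exact Or.inl ⟨hs, by rw [build1]⟩
    · exact Or.inr (Or.inl ⟨hs, by rw [build2]⟩)
    · exact Or.inr (Or.inr (Or.inl ⟨hs, by rw [build3]⟩))
  | play h h' hm =>
    obtain ⟨rfl, rfl⟩ := Prod.mk.inj e
    exact Or.inr (Or.inr (Or.inr ⟨rfl, h', rfl, hm⟩))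

lemma winA {n a b c : ℕ} (h : BULoss n (n, st (a+1) (b+1) c)) : BUFirstWin n (n, st a b (c+1)) := by
  refine .intro _ _ (.play _ _ ?_) h
  rw [← moveA]
  exact .split _ 2 le_rfl (by simp [st_apply])

lemma winB {n a b c : ℕ} (h : BULoss n (n, st (a+2) b c)) : BUFirstWin n (n, st a (b+1) c) := by
  refine .intro _ _ (.play _ _ ?_) h
  rw [← moveB]
  exact .splitTwo _ (by simp [st_apply])

lemma winC {n a b c : ℕ} (h : BULoss n (n, st a (b+2) c)) :
    BUFirstWin n (n, st (a+1) b (c+1)) := by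
  refine .intro _ _ (.play _ _ ?_) h
  rw [← moveC]
  exact .combineTwo _ (by simp [st_apply]) (by simp [st_apply])

lemma win1 {n s t a b c : ℕ} (hs : s + 1 ≤ n) (ht : t = s + 1)
    (h : BULoss n (t, st (a+1) b c)) : BUFirstWin n (s, st a b c) := by
  subst ht
  refine .intro _ _ ?_ h
  rw [← build1]
  exact .build s _ 1 (by simp) hs

lemma win2 {n s t a b c : ℕ} (hs : s + 2 ≤ n) (ht : t = s + 2)
    (h : BULoss n (t, st a (b+1) c)) : BUFirstWin n (s, st a b c) := by
  subst ht
  refine .intro _ _ ?_ h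
  rw [← build2]
  exact .build s _ 2 (by simp) hs

lemma win3 {n s t a b c : ℕ} (hs : s + 3 ≤ n) (ht : t = s + 3)
    (h : BULoss n (t, st a b (c+1))) : BUFirstWin n (s, st a b c) := by
  subst ht
  refine .intro _ _ ?_ h
  rw [← build3]
  exact .build s _ 3 (by simp) hs

lemma loss_build {n s a b c : ℕ} (hs : s < n)
    (h1 : BUFirstWin n (s+1, st (a+1) b c))
    (h2 : s + 2 ≤ n → BUFirstWin n (s+2, st a (b+1) c))
    (h3 : s + 3 ≤ n → BUFirstWin n (s+3, st a b (c+1))) : BULoss n (s, st a b c) := by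
  refine .intro _ fun q m => ?_
  rcases m.inv _ _ _ _ rfl with ⟨h, rfl⟩ | ⟨h, rfl⟩ | ⟨h, rfl⟩ | ⟨h, _⟩
  · exact h1
  · exact h2 h
  · exact h3 h
  · omega

/-- The outcome of the reversed Zeckendorf phase on three bins, `a + c` odd. -/
lemma phase (n : ℕ) : ∀ μ a b c : ℕ, 3 * c + b = μ → (a + c) % 2 = 1 →
    ((b % 2 = 0 ∧ (c ≤ a ↔ c % 2 = 0)) → BULoss n (n, st a b c)) ∧
    (¬ (b % 2 = 0 ∧ (c ≤ a ↔ c % 2 = 0)) → BUFirstWin n (n, st a b c)) := by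
  intro μ
  induction μ using Nat.strong_induction_on with
  | _ μ ih =>
  intro a b c hμ hac
  constructor
  · rintro ⟨hb, hc⟩
    refine .intro _ fun q m => ?_
    rcases m.inv _ _ _ _ rfl with ⟨h, _⟩ | ⟨h, _⟩ | ⟨h, _⟩ | ⟨_, h', rfl, hm⟩
    · omega
    · omega
    · omega
    rcases hm.inv _ _ _ rfl with ⟨c', rfl, rfl⟩ | ⟨b', rfl, rfl⟩ | ⟨a', c', rfl, rfl, rfl⟩
    · exact (ih _ (by omega) _ _ _ rfl (by omega)).2 (by omega)
    · exact (ih _ (by omega) _ _ _ rfl (by omega)).2 (by omega)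
    · exact (ih _ (by omega) _ _ _ rfl (by omega)).2 (by omega)
  · intro hn
    by_cases hb : b % 2 = 0
    · obtain ⟨a', rfl⟩ : ∃ a', a = a'+1 := ⟨a-1, by omega⟩
      obtain ⟨c', rfl⟩ : ∃ c', c = c'+1 := ⟨c-1, by omega⟩
      exact winC ((ih _ (by omega) _ _ _ rfl (by omega)).1 (by omega))
    · by_cases h : c ≤ a + 2 ↔ c % 2 = 0
      · obtain ⟨b', rfl⟩ : ∃ b', b = b'+1 := ⟨b-1, by omega⟩
        exact winB ((ih _ (by omega) _ _ _ rfl (by omega)).1 (by omega))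
      · obtain ⟨c', rfl⟩ : ∃ c', c = c'+1 := ⟨c-1, by omega⟩
        exact winA ((ih _ (by omega) _ _ _ rfl (by omega)).1 (by omega))

/-- The opponent faces a remaining total congruent to 1 mod 4. -/
lemma oppLoses (n : ℕ) (hn : n % 2 = 1) : ∀ m s a b c : ℕ, s = a + 2 * b + 3 * c →
    s + (4 * m + 1) = n → b % 2 = 1 → BULoss n (s, st a b c) := by
  intro m
  induction m with
  | zero =>
    intro s a b c hs hm hb
    refine loss_build (by omega) ?_ (by omega) (by omega)
    have e : s + 1 = n := by omega
    rw [e]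
    exact (phase n _ _ _ _ rfl (by omega)).2 (by omega)
  | succ m ih =>
    intro s a b c hs hm hb
    refine loss_build (by omega) ?_ (fun _ => ?_) (fun _ => ?_)
    · exact win3 (by omega) rfl (ih _ _ _ _ (by omega) (by omega) (by omega))
    · exact win2 (by omega) rfl (ih _ _ _ _ (by omega) (by omega) (by omega))
    · exact win1 (by omega) rfl (ih _ _ _ _ (by omega) (by omega) (by omega))

lemma meWins (n : ℕ) (hn : n % 2 = 1) : ∀ m s a b c : ℕ, s = a + 2 * b + 3 * c →
    s + (4 * m + 1) = n → b % 2 = 0 → c % 2 = m % 2 → c ≤ a → BUFirstWin n (s, st a b c) := by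
  intro m
  induction m with
  | zero =>
    intro s a b c hs hm hb hc hac
    refine win1 (t := n) (by omega) (by omega) ?_
    exact (phase n _ _ _ _ rfl (by omega)).1 (by omega)
  | succ m ih =>
    intro s a b c hs hm hb hc hac
    refine win1 (by omega) rfl ?_
    refine loss_build (by omega) ?_ (fun _ => ?_) (fun _ => ?_)
    · exact win2 (by omega) rfl (oppLoses n hn m _ _ _ _ (by omega) (by omega) (by omega))
    · exact win1 (by omega) rfl (oppLoses n hn m _ _ _ _ (by omega) (by omega) (by omega))
    · exact ih _ _ _ _ (by omega) (by omega) (by omega) (by omega) (by omega)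

/-- For every odd positive integer `n`, Player 1 has a winning strategy in the
Build Up 1-2-3 game on `n`. -/
theorem buildUpGame_odd_firstPlayerWin (n : ℕ) (hn : Odd n) :
    BUFirstWin n (0, 0) := by
  have hn' : n % 2 = 1 := Nat.odd_iff.1 hn
  have e0 : (0 : ZState) = st 0 0 0 := by simp [st]
  rw [e0]
  by_cases h4 : n % 4 = 3
  · exact win2 (by omega) rfl (oppLoses n hn' (n / 4) _ _ _ _ (by omega) (by omega) (by omega))
  by_cases h8 : (n / 4) % 2 = 0
  · exact meWins n hn' (n / 4) _ _ _ _ (by omega) (by omega) (by omega) (by omega) (by omega)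
  refine win2 (by omega) rfl (loss_build (by omega) ?_ (fun _ => ?_) (fun _ => ?_))
  · exact win1 (by omega) rfl (oppLoses n hn' (n / 4 - 1) _ _ _ _ (by omega) (by omega) (by omega))
  · exact meWins n hn' (n / 4 - 1) _ _ _ _ (by omega) (by omega) (by omega) (by omega) (by omega)
  · by_cases h5 : n = 5
    · subst h5
      exact (phase 5 _ _ _ _ rfl (by omega)).2 (by omega)
    · exact win3 (by omega) rfl
        (oppLoses n hn' (n / 4 - 2) _ _ _ _ (by omega) (by omega) (by omega))
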